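/- Let p ∈ [1, ∞), μ ∈ P_p(X), ν ∈ P_p(Y), and assume there exist finitely supported measures μ^n ∈ P(X), ν^n ∈ P(Y) with W_{p,bc}(μ^n, μ) → 0 and W_{p,bc}(ν^n, ν) → 0. Let π ∈ Π_•(μ, ν). Then there exist π^n ∈ Π_•(μ, ν) such that W_{p,c}(π, π^n) → 0 as n → ∞ and, for each n, there is a constant C_n > 0 with dπ^n/dP ≤ C_n holding P-almost surely, where P = μ ⊗ ν; here • stands for any of: no constraint, causal, anticausal, or bicausal. -/

import Mathlib

open MeasureTheory ProbabilityTheory Filter Set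
open scoped ENNReal NNReal Topology ProbabilityTheory

noncomputable section

namespace AOT

variable {N : ℕ}

/-- The σ-algebra on a path space generated by the `t`-th coordinate. -/
def coordσ (X : Fin N → Type*) [∀ t, MeasurableSpace (X t)] (t : Fin N) :
    MeasurableSpace (∀ s, X s) :=
  MeasurableSpace.comap (fun x => x t) inferInstance

/-- The σ-algebra generated by the coordinates (strictly) before time `t`, from a family
of coordinate σ-algebras. -/
def pastσOf {A : Type*} (m : Fin N → MeasurableSpace A) (t : ℕ) : MeasurableSpace A :=
  ⨆ s : Fin N, ⨆ _ : (s : ℕ) < t, m s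

/-- The σ-algebra on a path space generated by the coordinates before time `t`. -/
def pastσ (X : Fin N → Type*) [∀ t, MeasurableSpace (X t)] (t : ℕ) :
    MeasurableSpace (∀ s, X s) :=
  pastσOf (coordσ X) t

/-- Conditional independence of the sub-σ-algebras `m₁` and `m₂` given `m₃`, under the
measure `π`: for all sets `A ∈ m₁`, `B ∈ m₂`, the conditional expectation (given `m₃`)
of the indicator of `A ∩ B` is a.s. the product of those of `A` and of `B`. -/
def CondIndepσ {Ω : Type*} {mΩ : MeasurableSpace Ω} (m₁ m₂ m₃ : MeasurableSpace Ω)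
    (π : @Measure Ω mΩ) : Prop :=
  ∀ A B : Set Ω, MeasurableSet[m₁] A → MeasurableSet[m₂] B →
    (π[(A ∩ B).indicator (fun _ => (1 : ℝ)) | m₃]) =ᵐ[π]
      (π[A.indicator (fun _ => (1 : ℝ)) | m₃]) * (π[B.indicator (fun _ => (1 : ℝ)) | m₃])

/-- Causality of a measure on `A × B` relative to families of coordinate σ-algebras
`mA` on `A` and `mB` on `B`: for every time `t`, the `t`-th coordinate of the first
component is conditionally independent of the (strict) past of the second component,
given the (strict) past of the first component. -/
def IsCausalFor {A B : Type*} [MeasurableSpace A] [MeasurableSpace B]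
    (mA : Fin N → MeasurableSpace A) (mB : Fin N → MeasurableSpace B)
    (π : Measure (A × B)) : Prop :=
  ∀ t : Fin N,
    CondIndepσ ((mA t).comap Prod.fst)
      ((pastσOf mB (t : ℕ)).comap Prod.snd)
      ((pastσOf mA (t : ℕ)).comap Prod.fst) π

/-- Anticausality: causality with the roles of the two components exchanged. -/
def IsAnticausalFor {A B : Type*} [MeasurableSpace A] [MeasurableSpace B]
    (mA : Fin N → MeasurableSpace A) (mB : Fin N → MeasurableSpace B)
    (π : Measure (A × B)) : Prop :=
  IsCausalFor mB mA (π.map Prod.swap)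

/-- A coupling of a measure on `X₁ × ⋯ × X_N` and a measure on `Y₁ × ⋯ × Y_N` is causal if
under it, for every `t`, `Y_{1:t}` is conditionally independent of `X_{t+1}` given `X_{1:t}`. -/
def IsCausal {X Y : Fin N → Type*} [∀ t, MeasurableSpace (X t)] [∀ t, MeasurableSpace (Y t)]
    (π : Measure ((∀ t, X t) × (∀ t, Y t))) : Prop :=
  IsCausalFor (coordσ X) (coordσ Y) π

def IsAnticausal {X Y : Fin N → Type*} [∀ t, MeasurableSpace (X t)] [∀ t, MeasurableSpace (Y t)]
    (π : Measure ((∀ t, X t) × (∀ t, Y t))) : Prop :=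
  IsAnticausalFor (coordσ X) (coordσ Y) π

def IsBicausal {X Y : Fin N → Type*} [∀ t, MeasurableSpace (X t)] [∀ t, MeasurableSpace (Y t)]
    (π : Measure ((∀ t, X t) × (∀ t, Y t))) : Prop :=
  IsCausal π ∧ IsAnticausal π

/-- `π` is a coupling of `μ` and `ν`. -/
def IsCoupling {A B : Type*} [MeasurableSpace A] [MeasurableSpace B]
    (μ : Measure A) (ν : Measure B) (π : Measure (A × B)) : Prop :=
  π.map Prod.fst = μ ∧ π.map Prod.snd = ν

/-- The four flavors of (adapted) optimal transport: plain, causal, anticausal, bicausal. -/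
inductive Flavor | plain | causal | anticausal | bicausal

/-- The adaptedness constraint corresponding to a flavor. -/
def IsAdapted {X Y : Fin N → Type*} [∀ t, MeasurableSpace (X t)] [∀ t, MeasurableSpace (Y t)] :
    Flavor → Measure ((∀ t, X t) × (∀ t, Y t)) → Prop
  | .plain => fun _ => True
  | .causal => fun π => IsCausal π
  | .anticausal => fun π => IsAnticausal π
  | .bicausal => fun π => IsBicausal π

/-- The set `Π_•(μ, ν)` of couplings of `μ` and `ν` with the adaptedness constraint
given by the flavor `b`. -/
def aCouplings {X Y : Fin N → Type*} [∀ t, MeasurableSpace (X t)] [∀ t, MeasurableSpace (Y t)]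
    (b : Flavor) (μ : Measure (∀ t, X t)) (ν : Measure (∀ t, Y t)) :
    Set (Measure ((∀ t, X t) × (∀ t, Y t))) :=
  {π | IsCoupling μ ν π ∧ IsAdapted b π}

/-- `p`-th power transport cost of a coupling. -/
def lcost (p : ℝ) {A : Type*} [MeasurableSpace A] [PseudoEMetricSpace A]
    (π : Measure (A × A)) : ℝ≥0∞ :=
  ∫⁻ z, edist z.1 z.2 ^ p ∂π

/-- The (adapted) Wasserstein distance `W_{p,•}` between two measures on a path space. -/
def W {X : Fin N → Type*} [∀ t, MeasurableSpace (X t)] [∀ t, PseudoEMetricSpace (X t)]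
    (p : ℝ) (b : Flavor) (μ ν : Measure (∀ t, X t)) : ℝ≥0∞ :=
  (⨅ π : aCouplings b μ ν, lcost p π.1) ^ (1 / p)

/-- Coordinate σ-algebras on `X × Y` viewed as a single path space with
coordinates `X_t × Y_t`. -/
def coordσ2 (X Y : Fin N → Type*) [∀ t, MeasurableSpace (X t)] [∀ t, MeasurableSpace (Y t)]
    (t : Fin N) : MeasurableSpace ((∀ s, X s) × (∀ s, Y s)) :=
  ((coordσ X t).comap Prod.fst) ⊔ ((coordσ Y t).comap Prod.snd)

/-- Adaptedness for measures on `(X × Y) × (X × Y)`, where `X × Y` is regarded as a single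
path space with `N` time steps, the `t`-th coordinate being `X_t × Y_t`. -/
def IsAdapted2 {X Y : Fin N → Type*} [∀ t, MeasurableSpace (X t)] [∀ t, MeasurableSpace (Y t)] :
    Flavor → Measure (((∀ t, X t) × (∀ t, Y t)) × ((∀ t, X t) × (∀ t, Y t))) → Prop
  | .plain => fun _ => True
  | .causal => fun θ => IsCausalFor (coordσ2 X Y) (coordσ2 X Y) θ
  | .anticausal => fun θ => IsAnticausalFor (coordσ2 X Y) (coordσ2 X Y) θ
  | .bicausal => fun θ => IsCausalFor (coordσ2 X Y) (coordσ2 X Y) θ ∧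
      IsAnticausalFor (coordσ2 X Y) (coordσ2 X Y) θ

/-- The set `Π_•(π, π̃)` of couplings of two measures on `X × Y`, with adaptedness understood
for `X × Y` as one path space. -/
def aCouplings2 {X Y : Fin N → Type*} [∀ t, MeasurableSpace (X t)] [∀ t, MeasurableSpace (Y t)]
    (b : Flavor) (π ρ : Measure ((∀ t, X t) × (∀ t, Y t))) :
    Set (Measure (((∀ t, X t) × (∀ t, Y t)) × ((∀ t, X t) × (∀ t, Y t)))) :=
  {θ | IsCoupling π ρ θ ∧ IsAdapted2 b θ}

/-- `p`-th power transport cost `∫ d_X(x,x̃)^p + d_Y(y,ỹ)^p dθ` for couplings of couplings. -/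
def lcost2 (p : ℝ) {A B : Type*} [MeasurableSpace A] [MeasurableSpace B]
    [PseudoEMetricSpace A] [PseudoEMetricSpace B]
    (θ : Measure ((A × B) × (A × B))) : ℝ≥0∞ :=
  ∫⁻ z, (edist z.1.1 z.2.1 ^ p + edist z.1.2 z.2.2 ^ p) ∂θ

/-- The (adapted) Wasserstein distance `W_{p,•}(π, π̃)` between couplings, with cost
`d_X^p + d_Y^p` and `X × Y` regarded as one path space. -/
def W2 {X Y : Fin N → Type*} [∀ t, MeasurableSpace (X t)] [∀ t, MeasurableSpace (Y t)]
    [∀ t, PseudoEMetricSpace (X t)] [∀ t, PseudoEMetricSpace (Y t)]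
    (p : ℝ) (b : Flavor) (π ρ : Measure ((∀ t, X t) × (∀ t, Y t))) : ℝ≥0∞ :=
  (⨅ θ : aCouplings2 b π ρ, lcost2 p θ.1) ^ (1 / p)

/- Relative entropy (Kullback-Leibler divergence): `D_KL(π, ρ) = ∫ log (dπ/dρ) dπ` if
`π ≪ ρ` and the integral is defined, and `∞` otherwise. -/
open Classical in
def KL {Ω : Type*} [MeasurableSpace Ω] (π ρ : Measure Ω) : ℝ≥0∞ :=
  if π ≪ ρ ∧ Integrable (llr π ρ) π then ENNReal.ofReal (∫ ω, llr π ρ ω ∂π) else ⊤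

/-- The transport value `V_•(μ, ν, c)`. -/
def V {X Y : Fin N → Type*} [∀ t, MeasurableSpace (X t)] [∀ t, MeasurableSpace (Y t)]
    (b : Flavor) (μ : Measure (∀ t, X t)) (ν : Measure (∀ t, Y t))
    (c : (∀ t, X t) × (∀ t, Y t) → ℝ) : ℝ :=
  ⨅ π : aCouplings b μ ν, ∫ z, c z ∂π.1

/-- The entropic objective `∫ c dπ + ε D_KL(π, P)`, valued in `EReal`. -/
def entObj {Ω : Type*} [MeasurableSpace Ω] (c : Ω → ℝ) (ε : ℝ) (P : Measure Ω)
    (π : Measure Ω) : EReal :=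
  ((∫ z, c z ∂π : ℝ) : EReal) + (ε : EReal) * ((KL π P : ℝ≥0∞) : EReal)

/-- The entropic transport value `E_•^ε(μ, ν, c)`, valued in `EReal`. -/
def EE {X Y : Fin N → Type*} [∀ t, MeasurableSpace (X t)] [∀ t, MeasurableSpace (Y t)]
    (b : Flavor) (μ : Measure (∀ t, X t)) (ν : Measure (∀ t, Y t))
    (c : (∀ t, X t) × (∀ t, Y t) → ℝ) (ε : ℝ) : EReal :=
  ⨅ π : aCouplings b μ ν, entObj c ε (μ.prod ν) π.1

/-- The kernel `K(x, y) := K^μ(x) ⊗ K^ν(y)` used to build the shadow. -/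
def shadowKernel {A A' B B' : Type*} [MeasurableSpace A] [MeasurableSpace A']
    [MeasurableSpace B] [MeasurableSpace B']
    (Kμ : Kernel A A') (Kν : Kernel B B') : Kernel (A × B) (A' × B') :=
  (Kμ.comap Prod.fst measurable_fst) ×ₖ (Kν.comap Prod.snd measurable_snd)

/-- The `(K^μ, K^ν)`-shadow of `π`: the second marginal of `π ⊗ (K^μ ⊗ K^ν)`. -/
def shadow {A A' B B' : Type*} [MeasurableSpace A] [MeasurableSpace A']
    [MeasurableSpace B] [MeasurableSpace B']
    (π : Measure (A × B)) (Kμ : Kernel A A') (Kν : Kernel B B') : Measure (A' × B') :=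
  (π ⊗ₘ (shadowKernel Kμ Kν)).map Prod.snd

/-- `μ` has a finite `p`-th moment. -/
def MemPp {A : Type*} [MeasurableSpace A] [PseudoEMetricSpace A] (p : ℝ) (μ : Measure A) :
    Prop :=
  ∀ x₀ : A, ∫⁻ x, edist x₀ x ^ p ∂μ ≠ ⊤

/-- `c` has growth of order at most `p`. -/
def GrowthLE {A B : Type*} [PseudoEMetricSpace A] [PseudoEMetricSpace B]
    (p : ℝ) (c : A × B → ℝ) : Prop :=
  ∃ (x₀ : A) (y₀ : B) (M : ℝ), ∀ z : A × B,
    |c z| ≤ M * (1 + (edist x₀ z.1).toReal ^ p + (edist y₀ z.2).toReal ^ p)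

/-- Weak convergence of a sequence of measures (testing against bounded continuous
functions). -/
def WeakTendsto {A : Type*} [MeasurableSpace A] [TopologicalSpace A]
    (πs : ℕ → Measure A) (π : Measure A) : Prop :=
  ∀ f : BoundedContinuousFunction A ℝ,
    Tendsto (fun n => ∫ x, f x ∂(πs n)) atTop (𝓝 (∫ x, f x ∂π))

/-- A finitely supported (discrete) measure. -/
def FinitelySupported {A : Type*} [MeasurableSpace A] (μ : Measure A) : Prop :=
  ∃ s : Finset A, μ (↑s)ᶜ = 0

/-- `K` is a version of the conditional distribution of the random element `V` given the
sub-σ-algebra `m`, under the measure `ρ`. -/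
def IsCondDistrib' {Ω E : Type*} {mΩ : MeasurableSpace Ω} [MeasurableSpace E]
    (ρ : @Measure Ω mΩ) (V : Ω → E) (m : MeasurableSpace Ω) (K : Ω → Measure E) : Prop :=
  (∀ ω, IsProbabilityMeasure (K ω)) ∧
  (∀ A : Set E, MeasurableSet A → Measurable[m] (fun ω => (K ω A).toReal)) ∧
  (∀ A : Set E, MeasurableSet A →
    (ρ[(V ⁻¹' A).indicator (fun _ => (1 : ℝ)) | m]) =ᵐ[ρ] fun ω => (K ω A).toReal)

/-- `Kμ` is a family of disintegration kernels of `μ` on a path space: `Kμ t` is a version of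
the conditional distribution of the `t`-th coordinate given the past before `t`. -/
def IsDisintegration {X : Fin N → Type*} [∀ t, MeasurableSpace (X t)]
    (μ : Measure (∀ t, X t)) (Kμ : ∀ t : Fin N, (∀ s, X s) → Measure (X t)) : Prop :=
  ∀ t : Fin N, IsCondDistrib' μ (fun x => x t) (pastσ X (t : ℕ)) (Kμ t)

variable {X Y : Fin N → Type*} [∀ t, MeasurableSpace (X t)] [∀ t, MeasurableSpace (Y t)]

open Classical in
/-- Membership in the dual building block `A_{X,μ,t}` (relative to a fixed family `Kμ` of
disintegration kernels of `μ`): for `t = 1` the bounded measurable functions of `x₁`; for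
`t ≥ 2` functions `a_t(x_{1:t}, y_{1:t-1}) - ∫ a_t(x_{1:t-1}, x̃_t, y_{1:t-1}) μ_t^{x_{1:t-1}}(dx̃_t)`
with `a_t` bounded measurable. (Here `τ` is the 0-based coordinate index, `τ = t - 1`.) -/
def MemAX (Kμ : ∀ t : Fin N, (∀ s, X s) → Measure (X t)) (τ : Fin N)
    (f : (∀ t, X t) × (∀ t, Y t) → ℝ) : Prop :=
  if (τ : ℕ) = 0 then
    ∃ a : (∀ t, X t) × (∀ t, Y t) → ℝ,
      Measurable[(coordσ X τ).comap Prod.fst] a ∧ (∃ M, ∀ ω, |a ω| ≤ M) ∧ f = a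
  else
    ∃ a : (∀ t, X t) × (∀ t, Y t) → ℝ,
      Measurable[((pastσ X (τ : ℕ) ⊔ coordσ X τ).comap Prod.fst) ⊔
        ((pastσ Y (τ : ℕ)).comap Prod.snd)] a ∧ (∃ M, ∀ ω, |a ω| ≤ M) ∧
      f = fun ω => a ω - ∫ x', a (Function.update ω.1 τ x', ω.2) ∂(Kμ τ ω.1)

open Classical in
/-- Membership in the dual building block `A_{Y,ν,t}` (symmetric to `MemAX`). -/
def MemAY (Kν : ∀ t : Fin N, (∀ s, Y s) → Measure (Y t)) (τ : Fin N)
    (f : (∀ t, X t) × (∀ t, Y t) → ℝ) : Prop :=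
  if (τ : ℕ) = 0 then
    ∃ a : (∀ t, X t) × (∀ t, Y t) → ℝ,
      Measurable[(coordσ Y τ).comap Prod.snd] a ∧ (∃ M, ∀ ω, |a ω| ≤ M) ∧ f = a
  else
    ∃ a : (∀ t, X t) × (∀ t, Y t) → ℝ,
      Measurable[((pastσ X (τ : ℕ)).comap Prod.fst) ⊔
        ((pastσ Y (τ : ℕ) ⊔ coordσ Y τ).comap Prod.snd)] a ∧ (∃ M, ∀ ω, |a ω| ≤ M) ∧
      f = fun ω => a ω - ∫ y', a (ω.1, Function.update ω.2 τ y') ∂(Kν τ ω.2)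

/-- The dual space `S_{X,μ}`: sums `∑_{t=1}^N f_t` with `f_t ∈ A_{X,μ,t}`. -/
def MemSXμ (Kμ : ∀ t : Fin N, (∀ s, X s) → Measure (X t))
    (s : (∀ t, X t) × (∀ t, Y t) → ℝ) : Prop :=
  ∃ f : Fin N → ((∀ t, X t) × (∀ t, Y t) → ℝ),
    (∀ τ, MemAX Kμ τ (f τ)) ∧ s = fun ω => ∑ τ, f τ ω

/-- The dual space `S_{Y,ν}`: sums `∑_{t=1}^N g_t` with `g_t ∈ A_{Y,ν,t}`. -/
def MemSYν (Kν : ∀ t : Fin N, (∀ s, Y s) → Measure (Y t))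
    (s : (∀ t, X t) × (∀ t, Y t) → ℝ) : Prop :=
  ∃ g : Fin N → ((∀ t, X t) × (∀ t, Y t) → ℝ),
    (∀ τ, MemAY Kν τ (g τ)) ∧ s = fun ω => ∑ τ, g τ ω

/-- The space `S_X` of bounded measurable functions depending only on `x`. -/
def MemSX (s : (∀ t, X t) × (∀ t, Y t) → ℝ) : Prop :=
  ∃ g : (∀ t, X t) → ℝ, Measurable g ∧ (∃ M, ∀ x, |g x| ≤ M) ∧ s = fun ω => g ω.1

/-- The space `S_Y` of bounded measurable functions depending only on `y`. -/
def MemSY (s : (∀ t, X t) × (∀ t, Y t) → ℝ) : Prop :=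
  ∃ g : (∀ t, Y t) → ℝ, Measurable g ∧ (∃ M, ∀ y, |g y| ≤ M) ∧ s = fun ω => g ω.2

/-- The dual space `H_•`: `H = S_X ⊕ S_Y`, `H_c = S_{X,μ} ⊕ S_Y`, `H_{ac} = S_X ⊕ S_{Y,ν}`,
`H_{bc} = S_{X,μ} ⊕ S_{Y,ν}`. -/
def MemH (Kμ : ∀ t : Fin N, (∀ s, X s) → Measure (X t))
    (Kν : ∀ t : Fin N, (∀ s, Y s) → Measure (Y t)) :
    Flavor → ((∀ t, X t) × (∀ t, Y t) → ℝ) → Prop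
  | .plain => fun h => ∃ sX sY, MemSX (X := X) (Y := Y) sX ∧ MemSY sY ∧
      h = fun ω => sX ω + sY ω
  | .causal => fun h => ∃ sX sY, MemSXμ Kμ sX ∧ MemSY sY ∧ h = fun ω => sX ω + sY ω
  | .anticausal => fun h => ∃ sX sY, MemSX (X := X) (Y := Y) sX ∧ MemSYν Kν sY ∧
      h = fun ω => sX ω + sY ω
  | .bicausal => fun h => ∃ sX sY, MemSXμ Kμ sX ∧ MemSYν Kν sY ∧ h = fun ω => sX ω + sY ω

/-- The set `Π_c(μ, ∗)` of causal measures with first marginal `μ` and arbitrary second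
marginal. -/
def causalFirst (μ : Measure (∀ t, X t)) : Set (Measure ((∀ t, X t) × (∀ t, Y t))) :=
  {π | π.map Prod.fst = μ ∧ IsCausal π}

/-- The set `Π(∗, ν)` of couplings with arbitrary first marginal and second marginal `ν`. -/
def secondMarg (ν : Measure (∀ t, Y t)) : Set (Measure ((∀ t, X t) × (∀ t, Y t))) :=
  {π | π.map Prod.snd = ν}

/-- The set `Π_{ac}(∗, ν)` of anticausal measures with second marginal `ν`. -/
def anticausalSecond (ν : Measure (∀ t, Y t)) : Set (Measure ((∀ t, X t) × (∀ t, Y t))) :=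
  {π | π.map Prod.snd = ν ∧ IsAnticausal π}

/-- The reference measure `P_c` with `dP_c/dP = exp(-c)/∫ exp(-c) dP`. -/
def Pc {Ω : Type*} [MeasurableSpace Ω] (P : Measure Ω) (c : Ω → ℝ) : Measure Ω :=
  P.withDensity
    (fun ω => ENNReal.ofReal (Real.exp (-c ω)) / ∫⁻ ω', ENNReal.ofReal (Real.exp (-c ω')) ∂P)

/-- Sinkhorn's algorithm: `full 0 = π0`; `half k` is the `D_KL`-projection of `full k`
onto `Q1`, and `full (k+1)` is the `D_KL`-projection of `half k` onto `Q2`. -/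
structure IsSinkhorn {Ω : Type*} [MeasurableSpace Ω] (Q1 Q2 : Set (Measure Ω))
    (π0 : Measure Ω) (full half : ℕ → Measure Ω) : Prop where
  init : full 0 = π0
  half_mem : ∀ k, half k ∈ Q1
  half_opt : ∀ k, ∀ ρ ∈ Q1, KL (half k) (full k) ≤ KL ρ (full k)
  full_mem : ∀ k, full (k + 1) ∈ Q2
  full_opt : ∀ k, ∀ ρ ∈ Q2, KL (full (k + 1)) (half k) ≤ KL ρ (half k)

/-- The second projection set of Sinkhorn's algorithm: `Π(∗, ν)` for the causal problem and
`Π_{ac}(∗, ν)` for the bicausal problem. -/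
def sinkQ2 (b : Flavor) (ν : Measure (∀ t, Y t)) : Set (Measure ((∀ t, X t) × (∀ t, Y t))) :=
  match b with
  | .bicausal => anticausalSecond ν
  | _ => secondMarg ν

/-- The dual class of the second Sinkhorn potential: `S_Y` for the causal problem,
`S_{Y,ν}` for the bicausal problem. -/
def MemG (Kν : ∀ t : Fin N, (∀ s, Y s) → Measure (Y t)) :
    Flavor → ((∀ t, X t) × (∀ t, Y t) → ℝ) → Prop
  | .bicausal => fun g => MemSYν Kν g
  | _ => fun g => MemSY g

/-- Real-valued entropic transport value (`ε = 1`), the infimum being taken over couplings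
with finite relative entropy. -/
def Efin (b : Flavor) (μ : Measure (∀ t, X t)) (ν : Measure (∀ t, Y t))
    (c : (∀ t, X t) × (∀ t, Y t) → ℝ) : ℝ :=
  ⨅ π : {π : Measure ((∀ t, X t) × (∀ t, Y t)) //
      π ∈ aCouplings b μ ν ∧ KL π (μ.prod ν) ≠ ⊤},
    (∫ z, c z ∂π.1 + (KL π.1 (μ.prod ν)).toReal)

section AdaptedKernel

variable {A B C D : Type*} {F : MeasurableSpace A} {G : MeasurableSpace B}
  {F' H : MeasurableSpace C} {G' : MeasurableSpace D}
  {mA : MeasurableSpace A} {mB : MeasurableSpace B} {mC : MeasurableSpace C} {mD : MeasurableSpace D}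

/-- For every `G`-measurable set `S`, the map `x ↦ K x S` is `μ`-a.e. equal to an
`F`-measurable function. -/
def AdaptedKernel {A B : Type*} (F : MeasurableSpace A) (G : MeasurableSpace B)
    {mA : MeasurableSpace A} {mB : MeasurableSpace B} (μ : Measure A) (K : Kernel A B) : Prop :=
  ∀ S, MeasurableSet[G] S → ∃ f : A → ℝ≥0∞, Measurable[F] f ∧ (fun x => K x S) =ᵐ[μ] f

theorem adaptedKernel_const (μ : Measure A) (ν : Measure B) :
    AdaptedKernel F G μ (Kernel.const A ν) := fun S _ =>
  ⟨fun _ => ν S, @measurable_const _ _ _ F _, by simp⟩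

theorem AdaptedKernel.lintegral {μ : Measure A} {K : Kernel A B}
    (h : AdaptedKernel F G μ K) (hG : G ≤ mB)
    {g : B → ℝ≥0∞} (hg : Measurable[G] g) :
    ∃ f : A → ℝ≥0∞, Measurable[F] f ∧ (fun x => ∫⁻ y, g y ∂(K x)) =ᵐ[μ] f := by
  refine @Measurable.ennreal_induction B G (fun g => ∃ f : A → ℝ≥0∞, Measurable[F] f ∧
    (fun x => ∫⁻ y, g y ∂(K x)) =ᵐ[μ] f) (fun c S hS => ?_)
    (fun g₁ g₂ _ hg₁ _ h₁ h₂ => ?_) (fun g hg hmono ih => ?_) g hg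
  · obtain ⟨f, hf, hKf⟩ := h S hS
    refine ⟨fun x => c * f x, Measurable.const_mul hf c, ?_⟩
    filter_upwards [hKf] with x hx
    rw [lintegral_indicator_const (hG _ hS), hx]
  · obtain ⟨f₁, hf₁, hKf₁⟩ := h₁
    obtain ⟨f₂, hf₂, hKf₂⟩ := h₂
    refine ⟨f₁ + f₂, hf₁.add hf₂, ?_⟩
    filter_upwards [hKf₁, hKf₂] with x hx₁ hx₂
    simp only [Pi.add_apply]
    rw [lintegral_add_left (hg₁.mono hG le_rfl), hx₁, hx₂]
  · choose f hf hKf using ih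
    refine ⟨fun x => ⨆ n, f n x, Measurable.iSup hf, ?_⟩
    filter_upwards [ae_all_iff.2 hKf] with x hx
    rw [lintegral_iSup (fun n => (hg n).mono hG le_rfl) hmono]
    exact iSup_congr hx

theorem AdaptedKernel.comp {μ : Measure A} {K : Kernel A B} {L : Kernel B C}
    (hL : AdaptedKernel G H (K ∘ₘ μ) L) (hK : AdaptedKernel F G μ K) (hG : G ≤ mB)
    (hH : H ≤ mC) : AdaptedKernel F H μ (L ∘ₖ K) := by
  intro S hS
  obtain ⟨g, hg, hLg⟩ := hL S hS
  obtain ⟨f, hf, hKf⟩ := hK.lintegral hG hg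
  refine ⟨f, hf, ?_⟩
  filter_upwards [hKf, Measure.ae_ae_of_ae_comp hLg] with x hx hx'
  rw [Kernel.comp_apply' _ _ _ (hH _ hS), ← hx]
  exact lintegral_congr_ae hx'

theorem AdaptedKernel.parallelComp {π : Measure (A × C)} {K : Kernel A B} {L : Kernel C D}
    [IsMarkovKernel K] [IsMarkovKernel L]
    (hK : AdaptedKernel F G (π.map Prod.fst) K) (hL : AdaptedKernel F' G' (π.map Prod.snd) L)
    (hG : G ≤ mB) (hG' : G' ≤ mD) :
    AdaptedKernel (F.comap Prod.fst ⊔ F'.comap Prod.snd)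
      (G.comap Prod.fst ⊔ G'.comap Prod.snd) π (K ∥ₖ L) := by
  have hle : G.comap Prod.fst ⊔ G'.comap Prod.snd ≤ mB.prod mD :=
    sup_le_sup (MeasurableSpace.comap_mono hG) (MeasurableSpace.comap_mono hG')
  have hgen : G.comap Prod.fst ⊔ G'.comap Prod.snd =
      MeasurableSpace.generateFrom
        (image2 (· ×ˢ ·) {s : Set B | MeasurableSet[G] s} {t : Set D | MeasurableSet[G'] t}) :=
    (@generateFrom_prod B D G G').symm
  intro S hS
  induction S, hS using @MeasurableSpace.induction_on_inter _ _ _ _ hgen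
      (@isPiSystem_prod B D G G') with
  | empty => exact ⟨0, @measurable_zero _ _ _ (_) _, by simp; rfl⟩
  | basic S hS =>
    obtain ⟨S, hS, T, hT, rfl⟩ := hS
    obtain ⟨f, hf, hKf⟩ := hK S hS
    obtain ⟨g, hg, hLg⟩ := hL T hT
    refine ⟨(f ∘ Prod.fst) * (g ∘ Prod.snd), Measurable.mul
      (hf.comp (measurable_iff_comap_le.2 le_sup_left))
      (hg.comp (measurable_iff_comap_le.2 le_sup_right)), ?_⟩
    filter_upwards [ae_of_ae_map measurable_fst.aemeasurable hKf,
      ae_of_ae_map measurable_snd.aemeasurable hLg] with z h₁ h₂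
    rw [Kernel.parallelComp_apply_prod, h₁, h₂]; rfl
  | compl S hS ih =>
    obtain ⟨f, hf, hKf⟩ := ih
    refine ⟨fun z => 1 - f z, Measurable.const_sub hf 1, ?_⟩
    filter_upwards [hKf] with z hz
    rw [prob_compl_eq_one_sub (hle _ hS), hz]
  | iUnion S hd hS ih =>
    choose f hf hKf using ih
    refine ⟨fun z => ∑' n, f n z, @Measurable.tsum _ _ _ (_) _ _ _ _ _ _ _ _ _ _ _ _ hf, ?_⟩
    filter_upwards [ae_all_iff.2 hKf] with z hz
    rw [measure_iUnion hd fun n => hle _ (hS n)]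
    exact tsum_congr hz

end AdaptedKernel

section Causality

variable {A B : Type*}

theorem pastσOf_mono (m : Fin N → MeasurableSpace A) : Monotone (pastσOf m) := fun _ _ h =>
  iSup₂_mono' fun s hs => ⟨s, hs.trans_le h, le_rfl⟩

theorem pastσOf_succ (m : Fin N → MeasurableSpace A) (t : Fin N) :
    pastσOf m (t + 1) = pastσOf m t ⊔ m t := by
  refine le_antisymm (iSup₂_le fun s hs => ?_)
    (sup_le (pastσOf_mono m (Nat.le_succ _)) (le_iSup₂_of_le t (Nat.lt_succ_self _) le_rfl))
  rcases (Nat.lt_succ_iff.1 hs).lt_or_eq with h | h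
  · exact le_sup_of_le_left (le_iSup₂_of_le s h le_rfl)
  · rw [Fin.ext h]
    exact le_sup_right

variable {F : MeasurableSpace A} [mA : MeasurableSpace A] [mB : MeasurableSpace B]

theorem pastσOf_le {m : Fin N → MeasurableSpace A} (hm : ∀ t, m t ≤ mA) (t : ℕ) :
    pastσOf m t ≤ mA :=
  iSup₂_le fun s _ => hm s

theorem condExp_inter_eq {μ : Measure A} [IsProbabilityMeasure μ] {K : Kernel A B}
    [IsMarkovKernel K] (hF : F ≤ mA) {S : Set A} (hS : MeasurableSet S) {T : Set B}
    (hT : MeasurableSet T) {f : A → ℝ} (hf : Measurable[F] f)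
    (hKf : (fun x => (K x).real T) =ᵐ[μ] f) :
    (μ ⊗ₘ K)[(Prod.fst ⁻¹' S ∩ Prod.snd ⁻¹' T).indicator (fun _ => (1 : ℝ)) | F.comap Prod.fst]
      =ᵐ[μ ⊗ₘ K] (μ ⊗ₘ K)[(Prod.fst ⁻¹' S).indicator (fun _ => (1 : ℝ)) | F.comap Prod.fst]
        * (f ∘ Prod.fst) := by
  have hle : F.comap Prod.fst ≤ mA.prod mB :=
    (MeasurableSpace.comap_mono hF).trans le_sup_left
  have hS' : MeasurableSet (Prod.fst ⁻¹' S : Set (A × B)) := measurable_fst hS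
  have hT' : MeasurableSet (Prod.snd ⁻¹' T : Set (A × B)) := measurable_snd hT
  have hmap : (μ ⊗ₘ K).map Prod.fst = μ := Measure.fst_compProd μ K
  have hfint : Integrable f μ := by
    refine Integrable.congr ?_ hKf
    refine Integrable.of_bound (C := 1)
      ((Kernel.measurable_coe K hT).ennreal_toReal.aestronglyMeasurable) (ae_of_all _ fun x => ?_)
    rw [Real.norm_of_nonneg measureReal_nonneg]
    exact measureReal_le_one
  have hfint' : Integrable (f ∘ Prod.fst) (μ ⊗ₘ K) := by
    refine Integrable.comp_measurable ?_ measurable_fst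
    rwa [hmap]
  have hfm : Measurable[F.comap Prod.fst] (f ∘ Prod.fst : A × B → ℝ) :=
    hf.comp (comap_measurable _)
  have hmul : (Prod.fst ⁻¹' S).indicator (fun _ => (1 : ℝ)) * (f ∘ Prod.fst : A × B → ℝ)
      = (Prod.fst ⁻¹' S).indicator (f ∘ Prod.fst) := by
    ext z
    by_cases hz : z ∈ (Prod.fst ⁻¹' S : Set (A × B)) <;> simp [hz]
  have hpull := condExp_mul_of_stronglyMeasurable_right (m := F.comap Prod.fst) (μ := μ ⊗ₘ K)
    (f := (Prod.fst ⁻¹' S).indicator (fun _ => (1 : ℝ))) hfm.stronglyMeasurable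
    (by rw [hmul]; exact hfint'.indicator hS') ((integrable_const _).indicator hS')
  refine EventuallyEq.trans ?_ hpull
  rw [hmul]
  refine ae_eq_condExp_of_forall_setIntegral_eq hle (hfint'.indicator hS')
    (fun _ _ _ => integrable_condExp.integrableOn) (fun s hs _ => ?_)
    stronglyMeasurable_condExp.aestronglyMeasurable
  rw [setIntegral_condExp hle ((integrable_const _).indicator (hS'.inter hT')) hs]
  obtain ⟨P, hP, rfl⟩ := hs
  have hP' : MeasurableSet P := hF _ hP
  rw [setIntegral_indicator (hS'.inter hT'), setIntegral_indicator hS', setIntegral_const,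
    ← preimage_inter, show Prod.fst ⁻¹' P ∩ (Prod.fst ⁻¹' S ∩ Prod.snd ⁻¹' T) = (P ∩ S) ×ˢ T by
      ext; simp [and_assoc], smul_eq_mul, mul_one, measureReal_def,
    Measure.compProd_apply_prod (hP'.inter hS) hT]
  have : ∫ x in Prod.fst ⁻¹' (P ∩ S), (f ∘ Prod.fst) x ∂(μ ⊗ₘ K) = ∫ x in P ∩ S, f x ∂μ := by
    conv_rhs => rw [← hmap]
    rw [setIntegral_map (hP'.inter hS) (by rw [hmap]; exact hfint.aestronglyMeasurable)
      measurable_fst.aemeasurable]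
    rfl
  rw [this, ← integral_congr_ae (ae_restrict_of_ae hKf)]
  exact (integral_toReal (Kernel.measurable_coe K hT).aemeasurable
    (ae_of_all _ fun x => measure_lt_top _ _)).symm

theorem condExp_snd_eq {μ : Measure A} [IsProbabilityMeasure μ] {K : Kernel A B}
    [IsMarkovKernel K] (hF : F ≤ mA) {T : Set B}
    (hT : MeasurableSet T) {f : A → ℝ} (hf : Measurable[F] f)
    (hKf : (fun x => (K x).real T) =ᵐ[μ] f) :
    (μ ⊗ₘ K)[(Prod.snd ⁻¹' T).indicator (fun _ => (1 : ℝ)) | F.comap Prod.fst]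
      =ᵐ[μ ⊗ₘ K] f ∘ Prod.fst := by
  have hle : F.comap Prod.fst ≤ mA.prod mB :=
    (MeasurableSpace.comap_mono hF).trans le_sup_left
  have h := condExp_inter_eq hF MeasurableSet.univ hT hf hKf
  rw [preimage_univ, univ_inter, indicator_univ, condExp_const hle] at h
  exact h.trans (by simp [Pi.mul_def]; rfl)

theorem isCausalFor_of_adaptedKernel {m : Fin N → MeasurableSpace A}
    {m' : Fin N → MeasurableSpace B} (hm : ∀ t, m t ≤ mA) (hm' : ∀ t, m' t ≤ mB)
    {μ : Measure A} [IsProbabilityMeasure μ] {K : Kernel A B} [IsMarkovKernel K]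
    (h : ∀ t, AdaptedKernel (pastσOf m t) (pastσOf m' t) μ K) :
    IsCausalFor m m' (μ ⊗ₘ K) := by
  rintro t _ _ ⟨S, hS, rfl⟩ ⟨T, hT, rfl⟩
  obtain ⟨f, hf, hKf⟩ := h t T hT
  have hT' := pastσOf_le hm' _ _ hT
  have hf' : Measurable[pastσOf m t] fun x => (f x).toReal := hf.ennreal_toReal
  have hKf' : (fun x => (K x).real T) =ᵐ[μ] fun x => (f x).toReal :=
    hKf.fun_comp ENNReal.toReal
  have hF := pastσOf_le hm t
  refine (condExp_inter_eq hF (hm t _ hS) hT' hf' hKf').trans ?_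
  filter_upwards [condExp_snd_eq hF hT' hf' hKf'] with z hz
  simp only [Pi.mul_apply, hz]

/-- If `M₁` and `M₂` are conditionally independent given `M₃`, then conditioning an event of `M₂`
on `M₃ ⊔ M₁` is the same as conditioning it on `M₃`. -/
theorem CondIndepσ.condExp_sup {Ω : Type*} {M₁ M₂ M₃ : MeasurableSpace Ω}
    [mΩ : MeasurableSpace Ω] {ρ : Measure Ω} [IsProbabilityMeasure ρ]
    (h : CondIndepσ M₁ M₂ M₃ ρ) (h₁ : M₁ ≤ mΩ) (h₂ : M₂ ≤ mΩ) (h₃ : M₃ ≤ mΩ) {T : Set Ω}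
    (hT : MeasurableSet[M₂] T) :
    ρ[T.indicator (fun _ => (1 : ℝ)) | M₃ ⊔ M₁] =ᵐ[ρ] ρ[T.indicator (fun _ => (1 : ℝ)) | M₃] := by
  have hint : ∀ {U : Set Ω}, MeasurableSet U → Integrable (U.indicator (fun _ => (1 : ℝ))) ρ :=
    fun hU => (integrable_const _).indicator hU
  have hgen : M₃ ⊔ M₁ = MeasurableSpace.generateFrom
      (image2 (· ∩ ·) {s | MeasurableSet[M₃] s} {s | MeasurableSet[M₁] s}) :=
    le_antisymm
      (sup_le
        (fun s hs => MeasurableSpace.measurableSet_generateFrom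
          ⟨s, hs, univ, @MeasurableSet.univ _ M₁, inter_univ s⟩)
        (fun s hs => MeasurableSpace.measurableSet_generateFrom
          ⟨univ, @MeasurableSet.univ _ M₃, s, hs, univ_inter s⟩))
      (MeasurableSpace.generateFrom_le (by
        rintro _ ⟨s, hs, t, ht, rfl⟩
        exact (le_sup_left (a := M₃) (b := M₁) _ hs).inter (le_sup_right (a := M₃) (b := M₁) _ ht)))
  have hpi : IsPiSystem (image2 (· ∩ ·) {s | MeasurableSet[M₃] s} {s | MeasurableSet[M₁] s}) := by
    rintro _ ⟨s, hs, t, ht, rfl⟩ _ ⟨s', hs', t', ht', rfl⟩ _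
    exact ⟨s ∩ s', @MeasurableSet.inter _ M₃ _ _ hs hs', t ∩ t',
      @MeasurableSet.inter _ M₁ _ _ ht ht', inter_inter_inter_comm s s' t t'⟩
  have hle : M₃ ⊔ M₁ ≤ mΩ := sup_le h₃ h₁
  have hT' := h₂ _ hT
  refine (ae_eq_condExp_of_forall_setIntegral_eq hle (hint hT')
    (fun _ _ _ => integrable_condExp.integrableOn) (fun s hs _ => ?_)
    (stronglyMeasurable_condExp.mono (le_sup_left : M₃ ≤ M₃ ⊔ M₁)).aestronglyMeasurable).symm
  induction s, hs using @MeasurableSpace.induction_on_inter _ _ _ _ hgen hpi with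
  | empty => simp
  | basic s hs =>
    obtain ⟨P, hP, S, hS, rfl⟩ := hs
    have hS' := h₁ _ hS
    have hind : S.indicator (fun _ => (1 : ℝ)) * ρ[T.indicator (fun _ => (1 : ℝ)) | M₃]
        = S.indicator (ρ[T.indicator (fun _ => (1 : ℝ)) | M₃]) := by
      ext x
      by_cases hx : x ∈ S <;> simp [hx]
    have hindint : Integrable
        (S.indicator (fun _ => (1 : ℝ)) * ρ[T.indicator (fun _ => (1 : ℝ)) | M₃]) ρ := by
      rw [hind]
      exact integrable_condExp.indicator hS'
    have hpull := condExp_mul_of_stronglyMeasurable_right (m := M₃) (μ := ρ)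
      (f := S.indicator (fun _ => (1 : ℝ))) (g := ρ[T.indicator (fun _ => (1 : ℝ)) | M₃])
      stronglyMeasurable_condExp hindint (hint hS')
    calc ∫ x in P ∩ S, (ρ[T.indicator (fun _ => (1 : ℝ)) | M₃]) x ∂ρ
      _ = ∫ x in P, (S.indicator (fun _ => (1 : ℝ)) *
          ρ[T.indicator (fun _ => (1 : ℝ)) | M₃]) x ∂ρ := by
        rw [hind, setIntegral_indicator hS']
      _ = ∫ x in P, (ρ[(S ∩ T).indicator (fun _ => (1 : ℝ)) | M₃]) x ∂ρ := by
        rw [← setIntegral_condExp h₃ hindint hP]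
        exact integral_congr_ae (ae_restrict_of_ae (hpull.trans (h S T hS hT).symm))
      _ = ∫ x in P ∩ S, T.indicator (fun _ => (1 : ℝ)) x ∂ρ := by
        rw [setIntegral_condExp h₃ (hint (hS'.inter hT')) hP, setIntegral_indicator (hS'.inter hT'),
          setIntegral_indicator hT', inter_assoc]
  | compl s hs ih =>
    have h1 := integral_add_compl (hle _ hs) (integrable_condExp (m := M₃) (μ := ρ)
      (f := T.indicator (fun _ => (1 : ℝ))))
    have h2 := integral_add_compl (hle _ hs) (hint hT')
    rw [integral_condExp h₃] at h1
    linarith [ih (measure_lt_top _ _)]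
  | iUnion s hd hs ih =>
    rw [integral_iUnion (fun i => hle _ (hs i)) hd integrable_condExp.integrableOn,
      integral_iUnion (fun i => hle _ (hs i)) hd (hint hT').integrableOn]
    exact tsum_congr fun i => ih i (measure_lt_top _ _)

theorem IsCausalFor.adaptedKernel {m : Fin N → MeasurableSpace A}
    {m' : Fin N → MeasurableSpace B} (hm : ∀ t, m t ≤ mA) (hm' : ∀ t, m' t ≤ mB)
    (hmN : pastσOf m N = mA) {μ : Measure A} [IsProbabilityMeasure μ] {K : Kernel A B}
    [IsMarkovKernel K] (h : IsCausalFor m m' (μ ⊗ₘ K)) (t : ℕ) :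
    AdaptedKernel (pastσOf m t) (pastσOf m' t) μ K := by
  intro T hT
  have hT' := pastσOf_le hm' _ _ hT
  rcases le_or_gt N t with hNt | hNt
  · refine ⟨fun x => K x T, ?_, EventuallyEq.rfl⟩
    exact (Kernel.measurable_coe K hT').mono (hmN.symm.le.trans (pastσOf_mono m hNt)) le_rfl
  have hchain : ∀ s, t ≤ s → s ≤ N →
      (μ ⊗ₘ K)[(Prod.snd ⁻¹' T).indicator (fun _ => (1 : ℝ)) | (pastσOf m s).comap Prod.fst]
        =ᵐ[μ ⊗ₘ K] (μ ⊗ₘ K)[(Prod.snd ⁻¹' T).indicator (fun _ => (1 : ℝ)) |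
          (pastσOf m t).comap Prod.fst] := by
    intro s hs
    induction s, hs using Nat.le_induction with
    | base => exact fun _ => EventuallyEq.rfl
    | succ s hs ih =>
      intro hsN
      refine EventuallyEq.trans ?_ (ih (Nat.le_of_succ_le hsN))
      have hc := h ⟨s, hsN⟩
      rw [pastσOf_succ m ⟨s, hsN⟩, MeasurableSpace.comap_sup]
      exact hc.condExp_sup ((MeasurableSpace.comap_mono (hm _)).trans le_sup_left)
        ((MeasurableSpace.comap_mono (pastσOf_le hm' _)).trans le_sup_right)
        ((MeasurableSpace.comap_mono (pastσOf_le hm _)).trans le_sup_left)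
        ⟨T, pastσOf_mono m' hs _ hT, rfl⟩
  have hfull := condExp_snd_eq (F := mA) le_rfl hT'
    (Kernel.measurable_coe K hT').ennreal_toReal (μ := μ) EventuallyEq.rfl
  have hN := hchain N hNt.le le_rfl
  rw [hmN] at hN
  obtain ⟨g, hg, hgeq⟩ := @StronglyMeasurable.exists_eq_measurable_comp _ _ _ (pastσOf m t)
    Prod.fst ((μ ⊗ₘ K)[(Prod.snd ⁻¹' T).indicator (fun _ => (1 : ℝ)) |
          (pastσOf m t).comap Prod.fst]) _ _ _ stronglyMeasurable_condExp
  refine ⟨fun x => ENNReal.ofReal (g x), hg.measurable.ennreal_ofReal, ?_⟩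
  have hae : ∀ᵐ z ∂(μ ⊗ₘ K), K z.1 T = ENNReal.ofReal (g z.1) := by
    filter_upwards [hN.symm.trans hfull] with z hz
    rw [hgeq] at hz
    simp only [Function.comp_apply] at hz
    rw [hz, ENNReal.ofReal_toReal (measure_ne_top _ _)]
  rw [← Measure.fst_compProd μ K]
  refine (ae_map_iff measurable_fst.aemeasurable (measurableSet_eq_fun
    (Kernel.measurable_coe K hT') ?_)).2 hae
  exact (hg.measurable.mono (pastσOf_le hm t) le_rfl).ennreal_ofReal

end Causality

section Smoothing

variable {A B C : Type*} [mA : MeasurableSpace A] [mB : MeasurableSpace B]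
  [mC : MeasurableSpace C]

theorem compProd_comp_apply_prod {μ : Measure A} {μ' : Measure B} [SFinite μ] [SFinite μ']
    {K : Kernel A B} {R : Kernel B A} [IsMarkovKernel K] [IsMarkovKernel R]
    (h : (μ ⊗ₘ K).map Prod.swap = μ' ⊗ₘ R) {S T : Set A} (hS : MeasurableSet S)
    (hT : MeasurableSet T) :
    (μ ⊗ₘ (R ∘ₖ K)) (S ×ˢ T) = ∫⁻ z, R z S * R z T ∂μ' := by
  have hRT := Kernel.measurable_coe R hT
  have hind : Measurable (S.indicator (1 : A → ℝ≥0∞)) := measurable_one.indicator hS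
  have hm : Measurable fun w : A × B => S.indicator 1 w.1 * R w.2 T :=
    (hind.comp measurable_fst).mul (hRT.comp measurable_snd)
  have hm' : Measurable fun w : B × A => S.indicator 1 w.2 * R w.1 T :=
    (hind.comp measurable_snd).mul (hRT.comp measurable_fst)
  calc (μ ⊗ₘ (R ∘ₖ K)) (S ×ˢ T)
    _ = ∫⁻ x, S.indicator 1 x * ∫⁻ z, R z T ∂(K x) ∂μ := by
      rw [Measure.compProd_apply_prod hS hT, ← lintegral_indicator hS]
      refine lintegral_congr fun x => ?_
      by_cases hx : x ∈ S <;> simp [hx, Kernel.comp_apply' _ _ _ hT]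
    _ = ∫⁻ w, S.indicator 1 w.1 * R w.2 T ∂(μ ⊗ₘ K) := by
      rw [Measure.lintegral_compProd hm]
      exact lintegral_congr fun x => (lintegral_const_mul _ hRT).symm
    _ = ∫⁻ w, S.indicator 1 w.2 * R w.1 T ∂(μ' ⊗ₘ R) := by
      rw [← h, lintegral_map hm' measurable_swap]
      rfl
    _ = ∫⁻ z, R z S * R z T ∂μ' := by
      rw [Measure.lintegral_compProd hm']
      refine lintegral_congr fun z => ?_
      dsimp only
      rw [lintegral_mul_const _ hind, lintegral_indicator_one hS]

/-- If `R` is a reversal of `K`, then `R ∘ₖ K` is reversible. -/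
theorem map_swap_compProd_comp {μ : Measure A} {μ' : Measure B} [IsFiniteMeasure μ] [SFinite μ']
    {K : Kernel A B} {R : Kernel B A} [IsMarkovKernel K] [IsMarkovKernel R]
    (h : (μ ⊗ₘ K).map Prod.swap = μ' ⊗ₘ R) :
    (μ ⊗ₘ (R ∘ₖ K)).map Prod.swap = μ ⊗ₘ (R ∘ₖ K) := by
  refine Measure.ext_prod fun {S T} hS hT => ?_
  rw [Measure.map_apply measurable_swap (hS.prod hT), preimage_swap_prod,
    compProd_comp_apply_prod h hT hS, compProd_comp_apply_prod h hS hT]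
  simp_rw [mul_comm]

theorem parallelComp_comp_compProd {μ : Measure A} [IsFiniteMeasure μ] {L : Kernel A A}
    {Q : Kernel A B} {M : Kernel B C} [IsMarkovKernel L] [IsMarkovKernel Q] [IsMarkovKernel M]
    (hL : (μ ⊗ₘ L).map Prod.swap = μ ⊗ₘ L) :
    (L ∥ₖ M) ∘ₘ (μ ⊗ₘ Q) = μ ⊗ₘ (M ∘ₖ (Q ∘ₖ L)) := by
  refine Measure.ext_prod fun {S T} hS hT => ?_
  have hMT := Kernel.measurable_coe (M ∘ₖ Q) hT
  have hind : Measurable (S.indicator (1 : A → ℝ≥0∞)) := measurable_one.indicator hS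
  have hm : Measurable fun w : A × B => L w.1 S * M w.2 T :=
    ((Kernel.measurable_coe L hS).comp measurable_fst).mul
      ((Kernel.measurable_coe M hT).comp measurable_snd)
  have hm₁ : Measurable fun w : A × A => S.indicator 1 w.1 * (M ∘ₖ Q) w.2 T :=
    (hind.comp measurable_fst).mul (hMT.comp measurable_snd)
  have hm₂ : Measurable fun w : A × A => S.indicator 1 w.2 * (M ∘ₖ Q) w.1 T :=
    (hind.comp measurable_snd).mul (hMT.comp measurable_fst)
  calc ((L ∥ₖ M) ∘ₘ (μ ⊗ₘ Q)) (S ×ˢ T)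
    _ = ∫⁻ x, L x S * (M ∘ₖ Q) x T ∂μ := by
      rw [Measure.bind_apply (hS.prod hT) (Kernel.aemeasurable _)]
      simp_rw [Kernel.parallelComp_apply_prod]
      rw [Measure.lintegral_compProd hm]
      refine lintegral_congr fun x => ?_
      rw [Kernel.comp_apply' _ _ _ hT, ← lintegral_const_mul _ (Kernel.measurable_coe M hT)]
    _ = ∫⁻ w, S.indicator 1 w.2 * (M ∘ₖ Q) w.1 T ∂(μ ⊗ₘ L) := by
      rw [Measure.lintegral_compProd hm₂]
      refine lintegral_congr fun z => ?_
      dsimp only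
      rw [lintegral_mul_const _ hind, lintegral_indicator_one hS]
    _ = ∫⁻ w, S.indicator 1 w.1 * (M ∘ₖ Q) w.2 T ∂(μ ⊗ₘ L) := by
      conv_lhs => rw [← hL]
      rw [lintegral_map hm₂ measurable_swap]
      rfl
    _ = (μ ⊗ₘ (M ∘ₖ (Q ∘ₖ L))) (S ×ˢ T) := by
      rw [Measure.compProd_apply_prod hS hT, ← lintegral_indicator hS,
        Measure.lintegral_compProd hm₁]
      refine lintegral_congr fun x => ?_
      dsimp only
      rw [lintegral_const_mul _ hMT, ← Kernel.comp_assoc]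
      by_cases hx : x ∈ S <;> simp [hx, Kernel.comp_apply' _ _ _ hT]

theorem map_swap_parallelComp_comp (L : Kernel A A) (M : Kernel B B) (π : Measure (A × B)) :
    ((L ∥ₖ M) ∘ₘ π).map Prod.swap = (M ∥ₖ L) ∘ₘ (π.map Prod.swap) := by
  rw [← Measure.swap_comp, ← Measure.swap_comp, Measure.comp_assoc, Measure.comp_assoc,
    Kernel.swap_parallelComp]

theorem lcost_map_swap [PseudoEMetricSpace A] [SecondCountableTopology A]
    [OpensMeasurableSpace A] (p : ℝ) (γ : Measure (A × A)) :
    lcost p (γ.map Prod.swap) = lcost p γ := by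
  rw [lcost, lintegral_map (measurable_edist.pow_const p) measurable_swap, lcost]
  simp [edist_comm]

theorem lcost_compProd_comp_le [PseudoEMetricSpace A] [SecondCountableTopology A]
    [OpensMeasurableSpace A] {p : ℝ} (hp : 1 ≤ p) {μ μ' : Measure A} [SFinite μ] [SFinite μ']
    {K R : Kernel A A} [IsMarkovKernel K] [IsMarkovKernel R]
    (h : (μ ⊗ₘ K).map Prod.swap = μ' ⊗ₘ R) :
    lcost p (μ ⊗ₘ (R ∘ₖ K)) ≤ 2 ^ (p - 1) * (2 * lcost p (μ ⊗ₘ K)) := by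
  have hd : Measurable fun z : A × A => edist z.1 z.2 ^ p := measurable_edist.pow_const p
  have hd' : ∀ x : A, Measurable fun y => edist x y ^ p := fun x => hd.comp measurable_prodMk_left
  have hKμ : K ∘ₘ μ = μ' := by
    rw [← Measure.snd_compProd, ← Measure.fst_compProd μ' R, ← h, Measure.fst_map_swap]
  have hR : lcost p (μ' ⊗ₘ R) = lcost p (μ ⊗ₘ K) := by rw [← h, lcost_map_swap]
  have hinner : Measurable fun z => ∫⁻ y, edist z y ^ p ∂(R z) := hd.lintegral_kernel_prod_right
  have h2 : Measurable fun x => ∫⁻ z, edist x z ^ p ∂(K x) := hd.lintegral_kernel_prod_right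
  have h3 : Measurable fun x => ∫⁻ z, ∫⁻ y, edist z y ^ p ∂(R z) ∂(K x) := hinner.lintegral_kernel
  have h4 : Measurable fun x =>
      ∫⁻ z, edist x z ^ p ∂(K x) + ∫⁻ z, ∫⁻ y, edist z y ^ p ∂(R z) ∂(K x) := h2.add h3
  calc lcost p (μ ⊗ₘ (R ∘ₖ K))
    _ = ∫⁻ x, ∫⁻ z, ∫⁻ y, edist x y ^ p ∂(R z) ∂(K x) ∂μ := by
      rw [lcost, Measure.lintegral_compProd hd]
      exact lintegral_congr fun x => Kernel.lintegral_comp _ _ _ (hd' x)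
    _ ≤ ∫⁻ x, ∫⁻ z, 2 ^ (p - 1) * (edist x z ^ p + ∫⁻ y, edist z y ^ p ∂(R z)) ∂(K x) ∂μ := by
      refine lintegral_mono fun x => lintegral_mono fun z => ?_
      calc ∫⁻ y, edist x y ^ p ∂(R z)
        _ ≤ ∫⁻ y, 2 ^ (p - 1) * (edist x z ^ p + edist z y ^ p) ∂(R z) := by
          refine lintegral_mono fun y => ?_
          exact (ENNReal.rpow_le_rpow (edist_triangle x z y) (by linarith)).trans
            (ENNReal.rpow_add_le_mul_rpow_add_rpow _ _ hp)
        _ = _ := by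
          rw [lintegral_const_mul _ ((hd' z).const_add _), lintegral_add_left measurable_const]
          simp
    _ = 2 ^ (p - 1) * (lcost p (μ ⊗ₘ K) + lcost p (μ' ⊗ₘ R)) := by
      have h1 : ∀ x, Measurable fun z => edist x z ^ p + ∫⁻ y, edist z y ^ p ∂(R z) :=
        fun x => (hd' x).add hinner
      simp_rw [lintegral_const_mul _ (h1 _), lintegral_add_left (hd' _)]
      rw [lintegral_const_mul _ h4, lintegral_add_left h2, lcost, lcost,
        Measure.lintegral_compProd hd, Measure.lintegral_compProd hd, ← hKμ,
        Measure.lintegral_bind (Kernel.aemeasurable _) hinner.aemeasurable]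
    _ = 2 ^ (p - 1) * (2 * lcost p (μ ⊗ₘ K)) := by rw [hR, two_mul (lcost p _)]

theorem FinitelySupported.exists_kernel_le {μ' : Measure A} [MeasurableSingletonClass A]
    [IsFiniteMeasure μ'] (h : FinitelySupported μ') (R : Kernel A B) :
    ∃ c : ℝ≥0∞, c ≠ ⊤ ∧ ∀ᵐ z ∂μ', R z ≤ c • (R ∘ₘ μ') := by
  obtain ⟨s, hs⟩ := h
  classical
  refine ⟨∑ z ∈ s with μ' {z} ≠ 0, (μ' {z})⁻¹, ?_, ?_⟩
  · simp +contextual [ENNReal.sum_eq_top]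
  have hnull : ∀ᵐ z ∂μ', z ∈ s := by
    rw [ae_iff]
    exact hs
  have hatom : ∀ᵐ z ∂μ', z ∈ s → μ' {z} ≠ 0 := by
    rw [ae_iff]
    refine measure_mono_null (t := ⋃ z ∈ s.filter fun z => μ' {z} = 0, {z}) ?_ ?_
    · intro z hz
      simpa using hz
    · exact (measure_biUnion_null_iff (Finset.countable_toSet _)).2 fun z hz => by
        simpa using (Finset.mem_filter.1 hz).2
  filter_upwards [hnull, hatom] with z hz hz'
  refine Measure.le_iff.2 fun S hS => ?_
  have hne := hz' hz
  calc R z S = (μ' {z})⁻¹ * (R z S * μ' {z}) := by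
        rw [mul_comm (R z S), ← mul_assoc, ENNReal.inv_mul_cancel hne (measure_ne_top _ _), one_mul]
    _ ≤ (∑ z ∈ s with μ' {z} ≠ 0, (μ' {z})⁻¹) * (R ∘ₘ μ') S := by
        gcongr
        · exact Finset.single_le_sum (f := fun z => (μ' {z})⁻¹) (fun _ _ => zero_le)
            (Finset.mem_filter.2 ⟨hz, hne⟩)
        · rw [Measure.bind_apply hS (Kernel.aemeasurable _),
            ← lintegral_singleton (fun z => R z S) z]
          exact setLIntegral_le_lintegral _ _

end Smoothing

section SmoothingKernel

variable {X Y : Fin N → Type*}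

section Measurable

variable [∀ t, MeasurableSpace (X t)] [∀ t, MeasurableSpace (Y t)]

theorem coordσ_le (t : Fin N) : coordσ X t ≤ MeasurableSpace.pi :=
  le_iSup (fun s => MeasurableSpace.comap (fun x : ∀ s, X s => x s) inferInstance) t

theorem pastσOf_coordσ : pastσOf (coordσ X) N = MeasurableSpace.pi :=
  iSup_congr fun s => iSup_pos s.2

theorem coordσ2_le (t : Fin N) : coordσ2 X Y t ≤ Prod.instMeasurableSpace :=
  sup_le_sup (MeasurableSpace.comap_mono (coordσ_le t)) (MeasurableSpace.comap_mono (coordσ_le t))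

theorem pastσOf_coordσ2 (t : ℕ) :
    pastσOf (coordσ2 X Y) t =
      (pastσOf (coordσ X) t).comap Prod.fst ⊔ (pastσOf (coordσ Y) t).comap Prod.snd := by
  simp only [pastσOf, coordσ2, iSup_sup_eq, MeasurableSpace.comap_iSup]

/-- A reversible adapted Markov kernel on a path space with bounded densities
with respect to the reversible measure. -/
structure IsSmoothingKernel (μ : Measure (∀ t, X t)) (L : Kernel (∀ t, X t) (∀ t, X t)) :
    Prop where
  isMarkovKernel : IsMarkovKernel L
  map_swap : (μ ⊗ₘ L).map Prod.swap = μ ⊗ₘ L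
  adapted : ∀ t : ℕ, AdaptedKernel (pastσOf (coordσ X) t) (pastσOf (coordσ X) t) μ L
  exists_le : ∃ c : ℝ≥0∞, c ≠ ⊤ ∧ ∀ᵐ x ∂μ, L x ≤ c • μ

theorem IsSmoothingKernel.comp_eq {μ : Measure (∀ t, X t)} [SFinite μ]
    {L : Kernel (∀ t, X t) (∀ t, X t)} (h : IsSmoothingKernel μ L) : L ∘ₘ μ = μ := by
  have := h.isMarkovKernel
  rw [← Measure.snd_compProd, ← h.map_swap, Measure.snd_map_swap, Measure.fst_compProd]

theorem prod_mem_aCouplings_bicausal (μ : Measure (∀ t, X t)) (ν : Measure (∀ t, Y t))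
    [IsProbabilityMeasure μ] [IsProbabilityMeasure ν] : μ.prod ν ∈ aCouplings .bicausal μ ν := by
  refine ⟨⟨by simp, by simp⟩, ?_, ?_⟩
  · rw [IsCausal, ← Measure.compProd_const]
    exact isCausalFor_of_adaptedKernel coordσ_le coordσ_le fun t => adaptedKernel_const μ ν
  · rw [IsAnticausal, IsAnticausalFor, Measure.prod_swap, ← Measure.compProd_const]
    exact isCausalFor_of_adaptedKernel coordσ_le coordσ_le fun t => adaptedKernel_const ν μ

end Measurable

variable [∀ t, MeasurableSpace (X t)] [∀ t, MetricSpace (X t)]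
  [∀ t, PolishSpace (X t)] [∀ t, BorelSpace (X t)]

/-- A bicausal coupling `γ` of a finitely supported measure and `μ` induces a smoothing kernel
of `μ`: move from `μ` to the finitely supported measure and back along `γ`. -/
theorem exists_isSmoothingKernel {p : ℝ} (hp : 1 ≤ p) {μ' μ : Measure (∀ t, X t)}
    [IsProbabilityMeasure μ'] [IsProbabilityMeasure μ] (hμ' : FinitelySupported μ')
    {γ : Measure ((∀ t, X t) × (∀ t, X t))} (hγ : γ ∈ aCouplings .bicausal μ' μ) :
    ∃ L, IsSmoothingKernel μ L ∧ lcost p (μ ⊗ₘ L) ≤ 2 ^ (p - 1) * (2 * lcost p γ) := by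
  obtain ⟨⟨hfst, hsnd⟩, hc, hac⟩ := hγ
  have : IsProbabilityMeasure γ := by
    rw [← Measure.isProbabilityMeasure_map_iff measurable_fst.aemeasurable, hfst]
    infer_instance
  have : Nonempty (∀ t, X t) := nonempty_of_isProbabilityMeasure μ
  have hγ' : (γ.map Prod.swap).fst = μ := by rw [Measure.fst_map_swap, Measure.snd, hsnd]
  have : IsProbabilityMeasure (γ.map Prod.swap) :=
    Measure.isProbabilityMeasure_map measurable_swap.aemeasurable
  obtain ⟨R, hR, hγR⟩ : ∃ R : Kernel (∀ t, X t) (∀ t, X t), IsMarkovKernel R ∧ γ = μ' ⊗ₘ R :=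
    ⟨γ.condKernel, inferInstance, by rw [← hfst]; exact (γ.disintegrate _).symm⟩
  obtain ⟨K, hK, hγK⟩ : ∃ K : Kernel (∀ t, X t) (∀ t, X t), IsMarkovKernel K ∧
      γ.map Prod.swap = μ ⊗ₘ K :=
    ⟨(γ.map Prod.swap).condKernel, inferInstance, by
      conv_rhs => rw [← hγ']
      exact ((γ.map Prod.swap).disintegrate _).symm⟩
  have hrev : (μ ⊗ₘ K).map Prod.swap = μ' ⊗ₘ R := by
    rw [← hγK, ← hγR, Measure.map_map measurable_swap measurable_swap]
    simp
  have hKμ : K ∘ₘ μ = μ' := by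
    rw [← Measure.snd_compProd, ← Measure.fst_compProd μ' R, ← hrev, Measure.fst_map_swap]
  have hRμ : R ∘ₘ μ' = μ := by rw [← Measure.snd_compProd, ← hγR, Measure.snd, hsnd]
  refine ⟨R ∘ₖ K, ⟨inferInstance, map_swap_compProd_comp hrev, fun t => ?_, ?_⟩, ?_⟩
  · rw [IsCausal, hγR] at hc
    rw [IsAnticausal, IsAnticausalFor, hγK] at hac
    refine AdaptedKernel.comp (G := pastσOf (coordσ X) t) ?_
      (hac.adaptedKernel coordσ_le coordσ_le pastσOf_coordσ t)
      (pastσOf_le coordσ_le t) (pastσOf_le coordσ_le t)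
    rw [hKμ]
    exact hc.adaptedKernel coordσ_le coordσ_le pastσOf_coordσ t
  · obtain ⟨c, hc, hle⟩ := hμ'.exists_kernel_le R
    rw [hRμ, ← hKμ] at hle
    refine ⟨c, hc, ?_⟩
    filter_upwards [Measure.ae_ae_of_ae_comp hle] with x hx
    refine Measure.le_iff.2 fun S hS => ?_
    calc (R ∘ₖ K) x S = ∫⁻ z, R z S ∂(K x) := Kernel.comp_apply' _ _ _ hS
      _ ≤ ∫⁻ z, (c • μ) S ∂(K x) := lintegral_mono_ae (hx.mono fun z hz => hz S)
      _ = (c • μ) S := by simp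
  · refine (lcost_compProd_comp_le hp hrev).trans_eq ?_
    rw [← hγK, lcost_map_swap]

theorem exists_seq_isSmoothingKernel {p : ℝ} (hp : 1 ≤ p) {μ : Measure (∀ t, X t)}
    [IsProbabilityMeasure μ] {μs : ℕ → Measure (∀ t, X t)}
    (hμs : ∀ n, IsProbabilityMeasure (μs n)) (hμsd : ∀ n, FinitelySupported (μs n))
    (hμconv : Tendsto (fun n => W p .bicausal (μs n) μ) atTop (𝓝 0)) :
    ∃ Ls : ℕ → Kernel (∀ t, X t) (∀ t, X t), (∀ n, IsSmoothingKernel μ (Ls n)) ∧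
      Tendsto (fun n => lcost p (μ ⊗ₘ Ls n)) atTop (𝓝 0) := by
  have hp0 : 0 < p := by linarith
  set I : ℕ → ℝ≥0∞ := fun n => ⨅ γ : aCouplings .bicausal (μs n) μ, lcost p γ.1 with hI
  have hI0 : Tendsto I atTop (𝓝 0) := by
    have h := (ENNReal.continuous_rpow_const (y := p)).tendsto 0 |>.comp hμconv
    rw [ENNReal.zero_rpow_of_pos hp0] at h
    refine h.congr fun n => ?_
    simp only [Function.comp_apply, W, ← ENNReal.rpow_mul, one_div_mul_cancel hp0.ne',
      ENNReal.rpow_one, hI]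
  have hγ : ∀ n, ∃ γ ∈ aCouplings .bicausal (μs n) μ, lcost p γ ≤ I n + ((n : ℝ≥0∞) + 1)⁻¹ := by
    intro n
    rcases eq_or_ne (I n) ⊤ with h | h
    · exact ⟨_, prod_mem_aCouplings_bicausal (μs n) μ, by simp [h]⟩
    · have hlt : I n < I n + ((n : ℝ≥0∞) + 1)⁻¹ := ENNReal.lt_add_right h (by simp)
      obtain ⟨γ, hγ⟩ := iInf_lt_iff.1 hlt
      exact ⟨γ.1, γ.2, hγ.le⟩
  choose γ hγ hle using hγ
  choose L hL hLle using fun n => exists_isSmoothingKernel hp (hμsd n) (hγ n)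
  refine ⟨L, hL, tendsto_of_tendsto_of_tendsto_of_le_of_le tendsto_const_nhds ?_
    (fun _ => zero_le) fun n => (hLle n).trans (mul_le_mul_right (mul_le_mul_right (hle n) _) _)⟩
  have hinv : Tendsto (fun n : ℕ => ((n : ℝ≥0∞) + 1)⁻¹) atTop (𝓝 0) := by
    simpa using (tendsto_add_atTop_iff_nat 1).2 ENNReal.tendsto_inv_nat_nhds_zero
  have h := ENNReal.Tendsto.const_mul (a := 2 ^ (p - 1))
    (ENNReal.Tendsto.const_mul (a := 2) (hI0.add hinv) (.inr (by simp)))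
    (.inr (ENNReal.rpow_ne_top_of_nonneg (by linarith) (by simp)))
  simpa using h

end SmoothingKernel

section SmoothedCoupling

variable {X Y : Fin N → Type*} [∀ t, MeasurableSpace (X t)] [∀ t, MeasurableSpace (Y t)]
  {μ : Measure (∀ t, X t)} {ν : Measure (∀ t, Y t)}
  {π : Measure ((∀ t, X t) × (∀ t, Y t))}
  {L : Kernel (∀ t, X t) (∀ t, X t)} {M : Kernel (∀ t, Y t) (∀ t, Y t)}

theorem IsCoupling.swap {A B : Type*} [MeasurableSpace A] [MeasurableSpace B] {μ : Measure A}
    {ν : Measure B} {π : Measure (A × B)} (h : IsCoupling μ ν π) :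
    IsCoupling ν μ (π.map Prod.swap) :=
  ⟨(Measure.fst_map_swap (ρ := π)).trans h.2, (Measure.snd_map_swap (ρ := π)).trans h.1⟩

theorem IsCoupling.isProbabilityMeasure {A B : Type*} [MeasurableSpace A] [MeasurableSpace B]
    {μ : Measure A} [IsProbabilityMeasure μ] {ν : Measure B} {π : Measure (A × B)}
    (h : IsCoupling μ ν π) : IsProbabilityMeasure π := by
  rw [← Measure.isProbabilityMeasure_map_iff measurable_fst.aemeasurable, h.1]
  infer_instance

theorem IsCoupling.exists_eq_compProd {A B : Type*} [MeasurableSpace A] [MeasurableSpace B]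
    [StandardBorelSpace B] {μ : Measure A} {ν : Measure B} [IsProbabilityMeasure μ]
    [IsProbabilityMeasure ν] {π : Measure (A × B)} (h : IsCoupling μ ν π) :
    ∃ Q : Kernel A B, IsMarkovKernel Q ∧ π = μ ⊗ₘ Q := by
  have := h.isProbabilityMeasure
  have : Nonempty B := nonempty_of_isProbabilityMeasure ν
  exact ⟨π.condKernel, inferInstance, by rw [← h.1]; exact (π.disintegrate _).symm⟩

theorem IsSmoothingKernel.map_fst_parallelComp_comp [StandardBorelSpace (∀ t, Y t)]
    [IsProbabilityMeasure μ] [IsProbabilityMeasure ν] (hL : IsSmoothingKernel μ L)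
    (hM : IsSmoothingKernel ν M) (hπ : IsCoupling μ ν π) :
    ((L ∥ₖ M) ∘ₘ π).map Prod.fst = μ := by
  have := hL.isMarkovKernel
  have := hM.isMarkovKernel
  obtain ⟨Q, hQ, rfl⟩ := hπ.exists_eq_compProd
  rw [parallelComp_comp_compProd hL.map_swap]
  exact Measure.fst_compProd _ _

theorem IsSmoothingKernel.isCoupling [StandardBorelSpace (∀ t, X t)]
    [StandardBorelSpace (∀ t, Y t)] [IsProbabilityMeasure μ] [IsProbabilityMeasure ν]
    (hL : IsSmoothingKernel μ L) (hM : IsSmoothingKernel ν M) (hπ : IsCoupling μ ν π) :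
    IsCoupling μ ν ((L ∥ₖ M) ∘ₘ π) := by
  refine ⟨hL.map_fst_parallelComp_comp hM hπ, ?_⟩
  have h := hM.map_fst_parallelComp_comp hL hπ.swap
  rw [← map_swap_parallelComp_comp] at h
  exact (Measure.fst_map_swap (ρ := (L ∥ₖ M) ∘ₘ π)).symm.trans h

theorem IsSmoothingKernel.isCausal [StandardBorelSpace (∀ t, Y t)]
    [IsProbabilityMeasure μ] [IsProbabilityMeasure ν] (hL : IsSmoothingKernel μ L)
    (hM : IsSmoothingKernel ν M) (hπ : IsCoupling μ ν π) (hc : IsCausal π) :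
    IsCausal ((L ∥ₖ M) ∘ₘ π) := by
  have := hL.isMarkovKernel
  have := hM.isMarkovKernel
  obtain ⟨Q, hQ, rfl⟩ := hπ.exists_eq_compProd
  have hQμ : Q ∘ₘ μ = ν := by rw [← Measure.snd_compProd]; exact hπ.2
  rw [parallelComp_comp_compProd hL.map_swap]
  refine isCausalFor_of_adaptedKernel coordσ_le coordσ_le fun t => ?_
  have hX : pastσOf (coordσ X) t ≤ MeasurableSpace.pi := pastσOf_le coordσ_le t
  have hY : pastσOf (coordσ Y) t ≤ MeasurableSpace.pi := pastσOf_le coordσ_le t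
  have hQt : AdaptedKernel (pastσOf (coordσ X) t) (pastσOf (coordσ Y) t) (L ∘ₘ μ) Q := by
    rw [hL.comp_eq]
    exact IsCausalFor.adaptedKernel coordσ_le coordσ_le pastσOf_coordσ hc t
  refine AdaptedKernel.comp (G := pastσOf (coordσ Y) t) ?_ (hQt.comp (hL.adapted t) hX hY) hY hY
  rw [← Measure.comp_assoc, hL.comp_eq, hQμ]
  exact hM.adapted t

theorem IsSmoothingKernel.mem_aCouplings [StandardBorelSpace (∀ t, X t)]
    [StandardBorelSpace (∀ t, Y t)] [IsProbabilityMeasure μ] [IsProbabilityMeasure ν]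
    (hL : IsSmoothingKernel μ L) (hM : IsSmoothingKernel ν M) {b : Flavor}
    (hπ : π ∈ aCouplings b μ ν) : (L ∥ₖ M) ∘ₘ π ∈ aCouplings b μ ν := by
  have hac : IsAnticausal π → IsAnticausal ((L ∥ₖ M) ∘ₘ π) := fun h => by
    rw [IsAnticausal, IsAnticausalFor, map_swap_parallelComp_comp]
    exact hM.isCausal hL hπ.1.swap h
  refine ⟨hL.isCoupling hM hπ.1, ?_⟩
  obtain ⟨hπ, h⟩ := hπ
  cases b with
  | plain => trivial
  | causal => exact hL.isCausal hM hπ h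
  | anticausal => exact hac h
  | bicausal => exact ⟨hL.isCausal hM hπ h.1, hac h.2⟩

theorem IsSmoothingKernel.compProd_parallelComp_mem_aCouplings2 [IsProbabilityMeasure μ]
    (hL : IsSmoothingKernel μ L) (hM : IsSmoothingKernel ν M) (hπ : IsCoupling μ ν π) :
    π ⊗ₘ (L ∥ₖ M) ∈ aCouplings2 .causal π ((L ∥ₖ M) ∘ₘ π) := by
  have := hL.isMarkovKernel
  have := hM.isMarkovKernel
  have := hπ.isProbabilityMeasure
  refine ⟨⟨Measure.fst_compProd _ _, Measure.snd_compProd _ _⟩, ?_⟩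
  refine isCausalFor_of_adaptedKernel coordσ2_le coordσ2_le fun t => ?_
  rw [pastσOf_coordσ2]
  refine AdaptedKernel.parallelComp ?_ ?_ (pastσOf_le coordσ_le t) (pastσOf_le coordσ_le t)
  · rw [hπ.1]
    exact hL.adapted t
  · rw [hπ.2]
    exact hM.adapted t

theorem lcost2_compProd_parallelComp {A B : Type*} [MeasurableSpace A] [MeasurableSpace B]
    [PseudoEMetricSpace A] [SecondCountableTopology A] [OpensMeasurableSpace A]
    [PseudoEMetricSpace B] [SecondCountableTopology B] [OpensMeasurableSpace B]
    (p : ℝ) {μ : Measure A} {ν : Measure B} [SFinite μ] [SFinite ν] {π : Measure (A × B)}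
    [SFinite π] (hπ : IsCoupling μ ν π) (L : Kernel A A) (M : Kernel B B) [IsMarkovKernel L]
    [IsMarkovKernel M] :
    lcost2 p (π ⊗ₘ (L ∥ₖ M)) = lcost p (μ ⊗ₘ L) + lcost p (ν ⊗ₘ M) := by
  have hA : Measurable fun z : A × A => edist z.1 z.2 ^ p := measurable_edist.pow_const p
  have hB : Measurable fun z : B × B => edist z.1 z.2 ^ p := measurable_edist.pow_const p
  have h₁ : Measurable fun z : (A × B) × (A × B) => edist z.1.1 z.2.1 ^ p :=
    hA.comp (measurable_fst.fst.prodMk measurable_snd.fst)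
  have h₂ : Measurable fun z : (A × B) × (A × B) => edist z.1.2 z.2.2 ^ p :=
    hB.comp (measurable_fst.snd.prodMk measurable_snd.snd)
  have hL : Measurable fun x => ∫⁻ x', edist x x' ^ p ∂(L x) := hA.lintegral_kernel_prod_right
  have hM : Measurable fun y => ∫⁻ y', edist y y' ^ p ∂(M y) := hB.lintegral_kernel_prod_right
  rw [lcost2, lintegral_add_left h₁, Measure.lintegral_compProd h₁, Measure.lintegral_compProd h₂,
    lcost, lcost, Measure.lintegral_compProd hA, Measure.lintegral_compProd hB, ← hπ.1, ← hπ.2,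
    lintegral_map hL measurable_fst, lintegral_map hM measurable_snd]
  congr 1 <;> refine lintegral_congr fun z => ?_
  · have : L z.1 = ((L ∥ₖ M) z).map Prod.fst := by
      rw [Kernel.parallelComp_apply]
      simp
    have hz : Measurable fun w => edist z.1 w ^ p := hA.comp measurable_prodMk_left
    rw [this, lintegral_map hz measurable_fst]
  · have : M z.2 = ((L ∥ₖ M) z).map Prod.snd := by
      rw [Kernel.parallelComp_apply]
      simp
    have hz : Measurable fun w => edist z.2 w ^ p := hB.comp measurable_prodMk_left
    rw [this, lintegral_map hz measurable_snd]

theorem IsSmoothingKernel.exists_parallelComp_comp_le [IsProbabilityMeasure μ]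
    [IsProbabilityMeasure ν] (hL : IsSmoothingKernel μ L) (hM : IsSmoothingKernel ν M)
    (hπ : IsCoupling μ ν π) :
    ∃ c : ℝ≥0∞, 0 < c ∧ c ≠ ⊤ ∧ (L ∥ₖ M) ∘ₘ π ≤ c • μ.prod ν := by
  have := hL.isMarkovKernel
  have := hM.isMarkovKernel
  have := hπ.isProbabilityMeasure
  obtain ⟨c, hc, hLc⟩ := hL.exists_le
  obtain ⟨d, hd, hMd⟩ := hM.exists_le
  rw [← hπ.1] at hLc
  rw [← hπ.2] at hMd
  refine ⟨c * d + 1, by simp, by finiteness, Measure.le_iff.2 fun S hS => ?_⟩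
  rw [Measure.bind_apply hS (Kernel.aemeasurable _)]
  calc ∫⁻ z, (L ∥ₖ M) z S ∂π
    _ ≤ ∫⁻ z, ((c * d) • μ.prod ν) S ∂π := by
      refine lintegral_mono_ae ?_
      filter_upwards [ae_of_ae_map measurable_fst.aemeasurable hLc,
        ae_of_ae_map measurable_snd.aemeasurable hMd] with z hz hz'
      rw [Kernel.parallelComp_apply, ← smul_smul]
      refine (Measure.prod_mono hz hz' S).trans_eq ?_
      rw [hπ.1, hπ.2, Measure.prod_smul_left, Measure.prod_smul_right]
    _ ≤ ((c * d + 1) • μ.prod ν) S := by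
      rw [lintegral_const, measure_univ, mul_one, Measure.smul_apply, Measure.smul_apply]
      exact mul_le_mul_left le_self_add _

end SmoothedCoupling

theorem rnDeriv_le_of_le_smul {A : Type*} [MeasurableSpace A] {ρ P : Measure A} [SigmaFinite P]
    {c : ℝ≥0∞} (h : ρ ≤ c • P) : ρ.rnDeriv P ≤ᵐ[P] fun _ => c := by
  refine ae_le_of_forall_setLIntegral_le_of_sigmaFinite (Measure.measurable_rnDeriv _ _)
    fun S _ _ => ?_
  simpa using (Measure.setLIntegral_rnDeriv_le S).trans (h S)

/-- Smoothing of adapted couplings: if the marginals can be approximated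
in `W_{p,bc}` by finitely supported measures, then every `π ∈ Π_•(μ, ν)` can be approximated
in `W_{p,c}` by couplings `πⁿ ∈ Π_•(μ, ν)` with bounded density w.r.t. `P = μ ⊗ ν`. -/
theorem stmt_11 {N : ℕ} (X Y : Fin N → Type*)
    [∀ t, MeasurableSpace (X t)] [∀ t, MetricSpace (X t)]
    [∀ t, PolishSpace (X t)] [∀ t, BorelSpace (X t)]
    [∀ t, MeasurableSpace (Y t)] [∀ t, MetricSpace (Y t)]
    [∀ t, PolishSpace (Y t)] [∀ t, BorelSpace (Y t)]
    (p : ℝ) (hp : 1 ≤ p)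
    (μ : Measure (∀ t, X t)) (ν : Measure (∀ t, Y t))
    [IsProbabilityMeasure μ] [IsProbabilityMeasure ν]
    (hμp : MemPp p μ) (hνp : MemPp p ν)
    (μs : ℕ → Measure (∀ t, X t)) (νs : ℕ → Measure (∀ t, Y t))
    (hμs : ∀ n, IsProbabilityMeasure (μs n)) (hνs : ∀ n, IsProbabilityMeasure (νs n))
    (hμsd : ∀ n, FinitelySupported (μs n)) (hνsd : ∀ n, FinitelySupported (νs n))
    (hμconv : Tendsto (fun n => W p .bicausal (μs n) μ) atTop (𝓝 0))
    (hνconv : Tendsto (fun n => W p .bicausal (νs n) ν) atTop (𝓝 0))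
    (b : Flavor)
    (π : Measure ((∀ t, X t) × (∀ t, Y t))) (hπ : π ∈ aCouplings b μ ν) :
    ∃ πs : ℕ → Measure ((∀ t, X t) × (∀ t, Y t)),
      (∀ n, πs n ∈ aCouplings b μ ν) ∧
      Tendsto (fun n => W2 p .causal π (πs n)) atTop (𝓝 0) ∧
      ∀ n, πs n ≪ μ.prod ν ∧
        ∃ C : ℝ≥0∞, 0 < C ∧ C ≠ ⊤ ∧
          (πs n).rnDeriv (μ.prod ν) ≤ᵐ[μ.prod ν] fun _ => C := by
  have hp0 : 0 < 1 / p := by positivity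
  obtain ⟨L, hL, hLlim⟩ := exists_seq_isSmoothingKernel hp hμs hμsd hμconv
  obtain ⟨M, hM, hMlim⟩ := exists_seq_isSmoothingKernel hp hνs hνsd hνconv
  have := fun n => (hL n).isMarkovKernel
  have := fun n => (hM n).isMarkovKernel
  have := hπ.1.isProbabilityMeasure
  refine ⟨fun n => (L n ∥ₖ M n) ∘ₘ π, fun n => (hL n).mem_aCouplings (hM n) hπ, ?_, fun n => ?_⟩
  · have hlim : Tendsto (fun n => (lcost p (μ ⊗ₘ L n) + lcost p (ν ⊗ₘ M n)) ^ (1 / p))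
        atTop (𝓝 0) := by
      have h := ((ENNReal.continuous_rpow_const (y := 1 / p)).tendsto _).comp (hLlim.add hMlim)
      rwa [add_zero, ENNReal.zero_rpow_of_pos hp0] at h
    refine tendsto_of_tendsto_of_tendsto_of_le_of_le tendsto_const_nhds hlim (fun _ => zero_le)
      fun n => ENNReal.rpow_le_rpow ?_ hp0.le
    rw [← lcost2_compProd_parallelComp p hπ.1]
    exact iInf_le (fun θ : aCouplings2 .causal π _ => lcost2 p θ.1)
      ⟨_, (hL n).compProd_parallelComp_mem_aCouplings2 (hM n) hπ.1⟩
  · obtain ⟨c, hc0, hc, hle⟩ := (hL n).exists_parallelComp_comp_le (hM n) hπ.1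
    exact ⟨(Measure.absolutelyContinuous_of_le hle).trans Measure.smul_absolutelyContinuous,
      c, hc0, hc, rnDeriv_le_of_le_smul hle⟩

end AOT
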